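/- arXiv:math/9712296 — 3 statements merged into one kernel-verified Lean document; each statement's English description precedes it below -/
import Mathlib

section
/- Let p be a prime, n ≥ 1, and let 0 → A → E₁ → G → 0 and 0 → A → E₂ → G → 0 be two short exact sequences of abelian groups with p^n·G = 0. Let E₁ + E₂ denote their Baer sum, namely the quotient of the fibered product E₁ ×_G E₂ by the antidiagonal copy {(ι₁(a), −ι₂(a)) : a ∈ A} of A, which is again an extension of G by A. Then the p^n-map of the Baer sum E₁ + E₂ equals the (pointwise) sum of the p^n-maps of E₁ and E₂, as homomorphisms G → A/p^nA. -/
/-- The multiplication-by-`m` homomorphism of an abelian group. -/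
def nsmulHom (m : ℕ) (A : Type*) [AddCommGroup A] : A →+ A :=
  DistribMulAction.toAddMonoidHom A m

/-- `ψ : G →+ A/mA` is *the* `m`-map (snake map) of the extension `0 → A →ι E →π G → 0`
(with `m • G = 0`) if for every `g ∈ G`, every lift `e ∈ E` of `g` and every `a ∈ A` with
`ι a = m • e`, one has `ψ g = a mod mA`. -/
def IsSnakeMap {A E G : Type*} [AddCommGroup A] [AddCommGroup E] [AddCommGroup G]
    (m : ℕ) (ι : A →+ E) (π : E →+ G)
    (ψ : G →+ A ⧸ (nsmulHom m A).range) : Prop :=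
  ∀ (g : G) (e : E), π e = g → ∀ a : A, ι a = m • e → ψ g = QuotientAddGroup.mk a

/-- The fibered product `E₁ ×_G E₂ = {(e₁, e₂) : π₁ e₁ = π₂ e₂}`, as a subgroup of
`E₁ × E₂`. -/
def fiberedProduct {E₁ E₂ G : Type*} [AddCommGroup E₁] [AddCommGroup E₂] [AddCommGroup G]
    (π₁ : E₁ →+ G) (π₂ : E₂ →+ G) : AddSubgroup (E₁ × E₂) where
  carrier := {x | π₁ x.1 = π₂ x.2}
  zero_mem' := by simp
  add_mem' := by
    intro a b ha hb
    simp only [Set.mem_setOf_eq, Prod.fst_add, Prod.snd_add, map_add] at *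
    rw [ha, hb]
  neg_mem' := by
    intro a ha
    simp only [Set.mem_setOf_eq, Prod.fst_neg, Prod.snd_neg, map_neg] at *
    rw [ha]

/-- the `p^n`-map of the Baer sum of two extensions of `G` by `A` (the
quotient of the fibered product `E₁ ×_G E₂` by the antidiagonal copy
`{(ι₁ a, -ι₂ a) : a ∈ A}` of `A`) is the sum of the `p^n`-maps of the two extensions. -/
theorem snake_map_baer_sum
    {A E₁ E₂ G : Type*} [AddCommGroup A] [AddCommGroup E₁] [AddCommGroup E₂] [AddCommGroup G]
    (p : ℕ) (hp : p.Prime) (n : ℕ) (hn : 1 ≤ n)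
    (hG : ∀ g : G, p ^ n • g = 0)
    (ι₁ : A →+ E₁) (π₁ : E₁ →+ G)
    (hι₁ : Function.Injective ι₁) (hπ₁ : Function.Surjective π₁)
    (hexact₁ : ι₁.range = π₁.ker)
    (ι₂ : A →+ E₂) (π₂ : E₂ →+ G)
    (hι₂ : Function.Injective ι₂) (hπ₂ : Function.Surjective π₂)
    (hexact₂ : ι₂.range = π₂.ker)
    -- the antidiagonal embedding `a ↦ (ι₁ a, -ι₂ a)` of `A` into the fibered product
    (j : A →+ fiberedProduct π₁ π₂)
    (hj : ∀ a : A, ((j a : E₁ × E₂) : E₁ × E₂) = (ι₁ a, -ι₂ a))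
    -- the Baer sum `E₁ + E₂ := (E₁ ×_G E₂) ⧸ A`, as an extension of `G` by `A`
    (ιB : A →+ (fiberedProduct π₁ π₂ ⧸ j.range))
    (hιB : ∀ (a : A) (x : fiberedProduct π₁ π₂), ((x : E₁ × E₂) : E₁ × E₂) = (ι₁ a, 0) →
      ιB a = QuotientAddGroup.mk x)
    (πB : (fiberedProduct π₁ π₂ ⧸ j.range) →+ G)
    (hπB : ∀ x : fiberedProduct π₁ π₂, πB (QuotientAddGroup.mk x) = π₁ (x : E₁ × E₂).1)
    (ψ₁ : G →+ A ⧸ (nsmulHom (p ^ n) A).range)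
    (hψ₁ : IsSnakeMap (p ^ n) ι₁ π₁ ψ₁)
    (ψ₂ : G →+ A ⧸ (nsmulHom (p ^ n) A).range)
    (hψ₂ : IsSnakeMap (p ^ n) ι₂ π₂ ψ₂)
    (ψB : G →+ A ⧸ (nsmulHom (p ^ n) A).range)
    (hψB : IsSnakeMap (p ^ n) ιB πB ψB) :
    ψB = ψ₁ + ψ₂ := by
  ext g
  obtain ⟨e₁, he₁⟩ := hπ₁ g
  obtain ⟨e₂, he₂⟩ := hπ₂ g
  have h1 : p ^ n • e₁ ∈ ι₁.range := by
    rw [hexact₁, AddMonoidHom.mem_ker, map_nsmul, hG]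
  have h2 : p ^ n • e₂ ∈ ι₂.range := by
    rw [hexact₂, AddMonoidHom.mem_ker, map_nsmul, hG]
  obtain ⟨a₁, ha₁⟩ := h1
  obtain ⟨a₂, ha₂⟩ := h2
  have hx : (e₁, e₂) ∈ fiberedProduct π₁ π₂ := by
    change π₁ e₁ = π₂ e₂
    rw [he₁, he₂]
  have hy : (ι₁ (a₁ + a₂), (0 : E₂)) ∈ fiberedProduct π₁ π₂ := by
    change π₁ (ι₁ (a₁ + a₂)) = π₂ 0
    rw [map_zero, ← AddMonoidHom.mem_ker, ← hexact₁]
    exact ⟨_, rfl⟩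
  have hB : ιB (a₁ + a₂) = p ^ n • (QuotientAddGroup.mk (⟨(e₁, e₂), hx⟩ : fiberedProduct π₁ π₂) :
      fiberedProduct π₁ π₂ ⧸ j.range) := by
    rw [hιB _ ⟨_, hy⟩ rfl, ← QuotientAddGroup.mk_nsmul]
    symm
    rw [QuotientAddGroup.eq]
    refine ⟨a₂, Subtype.ext ?_⟩
    rw [hj]
    simp [← ha₁, ← ha₂]
  have hb := hψB g _ ((hπB ⟨(e₁, e₂), hx⟩).trans he₁) _ hB
  rw [hb, AddMonoidHom.add_apply, hψ₁ g e₁ he₁ a₁ ha₁, hψ₂ g e₂ he₂ a₂ ha₂]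
  rfl
end

section
/- Let R be a commutative ring, I an ideal of R, and γ = (γ_m)_{m ≥ 0} a divided power structure on I. Assume γ is nilpotent in the sense that for every x ∈ I there exists N with γ_m(x) = 0 for all m ≥ N. Then every element of 1 + I is a unit of R, and the map log : 1 + I → I defined by the (finite) sum log(1 + x) = Σ_{m ≥ 1} (−1)^{m−1} (m−1)!·γ_m(x) is a group homomorphism from the multiplicative group 1 + I to the additive group I; that is, log((1+x)(1+y)) = log(1+x) + log(1+y) for all x, y ∈ I. -/
/-- The divided power logarithm `log (1 + x) = ∑_{m ≥ 1} (-1)^(m-1) (m-1)! γ_m(x)`,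
written here as the (finite, under a nilpotence assumption) sum over `m ∈ ℕ` of
`(-1)^m * m! * γ_(m+1)(x)`. -/
noncomputable def dpLog {R : Type*} [CommRing R] {I : Ideal R}
    (hI : DividedPowers I) (x : R) : R :=
  ∑ᶠ m : ℕ, (-1 : R) ^ m * (m.factorial : R) * hI.dpow (m + 1) x

lemma dpl_pascal {R : Type*} [CommRing R] (x : R) (j M : ℕ) :
    (1 + x) * ∑ i ∈ Finset.range M, (-1 : R) ^ i * ((i + (j + 1)).choose (j + 1) : R) * x ^ i =
      ∑ i ∈ Finset.range M, (-1 : R) ^ i * ((i + j).choose j : R) * x ^ i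
        - (-1) ^ M * ((M + j).choose (j + 1) : R) * x ^ M := by
  induction M with
  | zero => simp
  | succ M ih =>
    rw [Finset.sum_range_succ, Finset.sum_range_succ, mul_add, ih]
    have e : M + 1 + j = M + (j + 1) := by omega
    have h : ((M + (j + 1)).choose (j + 1) : R) = (M + j).choose j + (M + j).choose (j + 1) := by
      rw [← add_assoc, Nat.choose_succ_succ]; push_cast; ring
    rw [e, h]
    ring

lemma dpl_inv {R : Type*} [CommRing R] (x : R) (M : ℕ) (hx : x ^ M = 0) (j : ℕ) :
    (1 + x) ^ (j + 1) *
      ∑ i ∈ Finset.range M, (-1 : R) ^ i * ((i + j).choose j : R) * x ^ i = 1 := by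
  induction j with
  | zero =>
    have h := mul_neg_geom_sum (-x) M
    have h0 : (-x) ^ M = 0 := by rw [neg_pow, hx, mul_zero]
    rw [h0, sub_neg_eq_add, sub_zero] at h
    simpa only [zero_add, pow_one, Nat.choose_zero_right, Nat.cast_one, mul_one, neg_pow x] using h
  | succ j ih =>
    rw [pow_succ, mul_assoc, dpl_pascal, hx, mul_zero, sub_zero, ih]

/-- Coefficients of the logarithm. -/
def dplC (R : Type*) [CommRing R] (n : ℕ) : R :=
  if n = 0 then 0 else (-1) ^ (n - 1) * ((n - 1).factorial : R)

lemma dpLog_eq {R : Type*} [CommRing R] {I : Ideal R} (hI : DividedPowers I) (x : R) (N : ℕ)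
    (h : ∀ m, N ≤ m → hI.dpow m x = 0) :
    dpLog hI x = ∑ n ∈ Finset.range N, dplC R n * hI.dpow n x := by
  have h1 : dpLog hI x = ∑ n ∈ Finset.range N, dplC R (n + 1) * hI.dpow (n + 1) x := by
    unfold dpLog
    rw [finsum_eq_sum_of_support_subset (s := Finset.range N)]
    · simp [dplC]
    · intro m hm
      by_contra hc
      apply hm
      simp only [Finset.coe_range, Set.mem_Iio, not_lt] at hc
      simp [h (m + 1) (by omega)]
  have h2 := Finset.sum_range_succ' (fun n => dplC R n * hI.dpow n x) N
  rw [Finset.sum_range_succ, h N le_rfl, mul_zero, add_zero] at h2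
  rw [h1, h2]
  simp [dplC]

lemma dpl_core {R : Type*} [CommRing R] {I : Ideal R} (hI : DividedPowers I) (x : R)
    (hx : x ∈ I) (N : ℕ) (hN : x ^ N = 0) (j : ℕ) :
    (1 + x) ^ (j + 1) * ∑ i ∈ Finset.range N, dplC R (i + (j + 1)) * hI.dpow i x
      = dplC R (j + 1) := by
  have key : ∀ i, dplC R (i + (j + 1)) * hI.dpow i x =
      dplC R (j + 1) * ((-1 : R) ^ i * ((i + j).choose j : R) * x ^ i) := by
    intro i
    rw [← hI.factorial_mul_dpow_eq_pow hx]
    have hf : ((i + j).factorial : R) = (i + j).choose j * i.factorial * j.factorial := by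
      rw [← Nat.add_choose_mul_factorial_mul_factorial i j]
      push_cast; ring
    simp only [dplC, ← add_assoc, Nat.add_sub_cancel, Nat.succ_ne_zero, if_false, hf]
    ring
  rw [Finset.sum_congr rfl (fun i _ => key i), ← Finset.mul_sum, mul_left_comm,
    dpl_inv x N hN, mul_one]

lemma dpl_main {R : Type*} [CommRing R] {I : Ideal R} (hI : DividedPowers I) (x y : R)
    (hx : x ∈ I) (hy : y ∈ I) (N : ℕ) (hNx : ∀ m, N ≤ m → hI.dpow m x = 0)
    (hNy : ∀ m, N ≤ m → hI.dpow m y = 0) :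
    dpLog hI (x + y + x * y) = dpLog hI x + dpLog hI y := by
  have hz : ∀ n, hI.dpow n (x + y + x * y) = ∑ p ∈ Finset.HasAntidiagonal.antidiagonal n,
      hI.dpow p.1 x * ((1 + x) ^ p.2 * hI.dpow p.2 y) := by
    intro n
    rw [show x + y + x * y = x + (1 + x) * y by ring, hI.dpow_add hx (I.mul_mem_left _ hy)]
    simp only [hI.dpow_mul hy]
  have hzN : ∀ m, 2 * N ≤ m → hI.dpow m (x + y + x * y) = 0 := by
    intro m hm
    rw [hz]
    refine Finset.sum_eq_zero fun p hp => ?_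
    rw [Finset.HasAntidiagonal.mem_antidiagonal] at hp
    rcases le_or_gt N p.1 with h | h
    · rw [hNx _ h, zero_mul]
    · rw [hNy p.2 (by omega), mul_zero, mul_zero]
  have hxN : x ^ N = 0 := by
    rw [← hI.factorial_mul_dpow_eq_pow hx, hNx N le_rfl, mul_zero]
  let F : ℕ × ℕ → R := fun p =>
    dplC R (p.1 + p.2) * (hI.dpow p.1 x * ((1 + x) ^ p.2 * hI.dpow p.2 y))
  have h1 : dpLog hI (x + y + x * y) =
      ∑ p ∈ Finset.range N ×ˢ Finset.range N, F p := by
    rw [dpLog_eq hI _ _ hzN, ← Finset.sum_fiberwise_of_maps_to (t := Finset.range (2 * N))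
      (g := fun p : ℕ × ℕ => p.1 + p.2)]
    · refine Finset.sum_congr rfl fun n _ => ?_
      rw [hz, Finset.mul_sum]
      symm
      have : ∑ p ∈ Finset.HasAntidiagonal.antidiagonal n,
          dplC R n * (hI.dpow p.1 x * ((1 + x) ^ p.2 * hI.dpow p.2 y)) =
          ∑ p ∈ Finset.HasAntidiagonal.antidiagonal n, F p :=
        Finset.sum_congr rfl fun p hp => by
          rw [Finset.HasAntidiagonal.mem_antidiagonal] at hp
          simp only [F, hp]
      rw [this]
      refine Finset.sum_subset ?_ ?_
      · intro p hp
        exact Finset.HasAntidiagonal.mem_antidiagonal.2 (Finset.mem_filter.1 hp).2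
      · intro p hp hp'
        rw [Finset.HasAntidiagonal.mem_antidiagonal] at hp
        simp only [Finset.mem_filter, Finset.mem_product, Finset.mem_range, hp, and_true,
          not_and_or, not_lt] at hp'
        rcases hp' with h | h
        · simp [F, hNx _ h]
        · simp [F, hNy _ h]
    · intro p hp
      simp only [Finset.mem_product, Finset.mem_range] at hp ⊢
      omega
  have h2 : ∀ j, ∑ i ∈ Finset.range N, F (i, j + 1) = dplC R (j + 1) * hI.dpow (j + 1) y := by
    intro j
    rw [← dpl_core hI x hx N hxN j, Finset.mul_sum, Finset.sum_mul]
    refine Finset.sum_congr rfl fun i _ => ?_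
    simp only [F]
    ring
  rw [h1, Finset.sum_product_right, dpLog_eq hI x N hNx, dpLog_eq hI y N hNy]
  cases N with
  | zero => simp
  | succ N =>
    rw [Finset.sum_range_succ' (fun j => ∑ i ∈ Finset.range (N + 1), F (i, j)),
      Finset.sum_range_succ' (fun n => dplC R n * hI.dpow n y),
      Finset.sum_congr rfl (fun j _ => h2 j), add_comm]
    simp [F, dplC, hI.dpow_zero hy]

/-- if `γ` is a nilpotent divided power structure on an ideal `I` of a
commutative ring `R`, then every element of `1 + I` is a unit, the logarithm
`log(1 + x) = ∑_{m ≥ 1} (-1)^(m-1) (m-1)! γ_m(x)` takes values in `I`, and it is a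
homomorphism from the multiplicative group `1 + I` to the additive group `I`:
`log((1+x)(1+y)) = log(1+x) + log(1+y)`, i.e. `log(1 + (x+y+xy)) = log(1+x) + log(1+y)`. -/
theorem dividedPowers_log_isHom {R : Type*} [CommRing R] (I : Ideal R)
    (hI : DividedPowers I)
    (hnil : ∀ x ∈ I, ∃ N : ℕ, ∀ m : ℕ, N ≤ m → hI.dpow m x = 0) :
    (∀ x ∈ I, IsUnit (1 + x)) ∧
    (∀ x ∈ I, dpLog hI x ∈ I) ∧
    (∀ x ∈ I, ∀ y ∈ I,
      (1 + x) * (1 + y) = 1 + (x + y + x * y) ∧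
      dpLog hI (x + y + x * y) = dpLog hI x + dpLog hI y) := by
  refine ⟨?_, ?_, ?_⟩
  · intro x hx
    obtain ⟨N, hN⟩ := hnil x hx
    have hxN : x ^ N = 0 := by
      rw [← hI.factorial_mul_dpow_eq_pow hx, hN N le_rfl, mul_zero]
    have h := dpl_inv x N hxN 0
    rw [zero_add, pow_one] at h
    exact IsUnit.of_mul_eq_one _ h
  · intro x hx
    obtain ⟨N, hN⟩ := hnil x hx
    rw [dpLog_eq hI x N hN]
    refine Ideal.sum_mem _ fun n _ => ?_
    rcases Nat.eq_zero_or_pos n with h | h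
    · simp [h, dplC]
    · exact I.mul_mem_left _ (hI.dpow_mem h.ne' hx)
  · intro x hx y hy
    obtain ⟨N, hN⟩ := hnil x hx
    obtain ⟨M, hM⟩ := hnil y hy
    exact ⟨by ring, dpl_main hI x y hx hy (max N M)
      (fun m h => hN m (le_trans (le_max_left _ _) h))
      (fun m h => hM m (le_trans (le_max_right _ _) h))⟩
end

section
/- Let p be a prime, n ≥ 1, let A be a commutative ring and B a commutative A-algebra such that B has no p-torsion (p·b = 0 implies b = 0). Let d : B → Ω_{B/A} be the universal A-derivation and set B' = {x ∈ B : d(x) = 0}, an A-subalgebra of B. Assume: (1) every element of Ω_{B/A} is of the form d(b) for some b ∈ B, and (2) Ω_{B/A} is p-divisible, i.e. p·Ω_{B/A} = Ω_{B/A}. Then there is a short exact sequence of abelian groups 0 → Ω_{B/A}[p^n] → B'/p^nB' → B/p^nB → 0, where Ω_{B/A}[p^n] = {ω ∈ Ω_{B/A} : p^n·ω = 0}; the second map is induced by the inclusion B' ⊆ B; and the first map sends ω = d(b) (note that p^n·ω = 0 forces p^n·b ∈ B') to the class of p^n·b in B'/p^nB', this being independent of the choice of b with d(b) = ω. -/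
/-- The `A`-subalgebra `B' = {x ∈ B : d x = 0}` of elements with vanishing Kähler
differential. -/
def dKernel (A B : Type*) [CommRing A] [CommRing B] [Algebra A B] : Subalgebra A B where
  carrier := {x | KaehlerDifferential.D A B x = 0}
  mul_mem' := by
    intro a b ha hb
    simp only [Set.mem_setOf_eq] at *
    rw [Derivation.leibniz, ha, hb, smul_zero, smul_zero, add_zero]
  one_mem' := by simp only [Set.mem_setOf_eq, Derivation.map_one_eq_zero]
  add_mem' := by
    intro a b ha hb
    simp only [Set.mem_setOf_eq] at *
    rw [map_add, ha, hb, add_zero]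
  algebraMap_mem' := by
    intro r
    simp only [Set.mem_setOf_eq, Derivation.map_algebraMap]

/-- let `B` be a commutative `A`-algebra without `p`-torsion, with universal
derivation `d : B → Ω[B⁄A]` and `B' = ker d`.  If every element of `Ω[B⁄A]` is of the
form `d b`, and `Ω[B⁄A]` is `p`-divisible, then there is a short exact sequence
`0 → Ω[B⁄A][p^n] → B'/p^nB' → B/p^nB → 0`, where the second map is induced by the
inclusion `B' ⊆ B` and the first map sends `ω = d b` to the class of `p^n • b`
(note `p^n • ω = 0` forces `p^n • b ∈ B'`). -/
theorem kaehler_torsion_exact_sequence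
    (p : ℕ) (hp : p.Prime) (n : ℕ) (hn : 1 ≤ n)
    (A B : Type*) [CommRing A] [CommRing B] [Algebra A B]
    (hBtor : ∀ b : B, p • b = 0 → b = 0)
    (hsurj : ∀ ω : Ω[B⁄A], ∃ b : B, KaehlerDifferential.D A B b = ω)
    (hdiv : ∀ ω : Ω[B⁄A], ∃ ω' : Ω[B⁄A], p • ω' = ω) :
    -- `p^n • ω = 0` forces `p^n • b ∈ B'`
    (∀ b : B, p ^ n • KaehlerDifferential.D A B b = 0 → p ^ n • b ∈ dKernel A B) ∧
    -- the short exact sequence `0 → Ω[B⁄A][p^n] → B'/p^nB' → B/p^nB → 0`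
    (∃ (ι : (nsmulHom (p ^ n) (Ω[B⁄A])).ker →+
          (dKernel A B ⧸ (nsmulHom (p ^ n) (dKernel A B)).range))
       (π : (dKernel A B ⧸ (nsmulHom (p ^ n) (dKernel A B)).range) →+
          (B ⧸ (nsmulHom (p ^ n) B).range)),
      -- the first map sends `ω = d b` to the class of `p^n • b`,
      -- independently of the choice of `b`
      (∀ (ω : (nsmulHom (p ^ n) (Ω[B⁄A])).ker) (b : B),
        KaehlerDifferential.D A B b = (ω : Ω[B⁄A]) →
        ∀ x : dKernel A B, (x : B) = p ^ n • b → ι ω = QuotientAddGroup.mk x) ∧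
      -- the second map is induced by the inclusion `B' ⊆ B`
      (∀ x : dKernel A B,
        π (QuotientAddGroup.mk x) = QuotientAddGroup.mk (x : B)) ∧
      Function.Injective ι ∧ Function.Surjective π ∧ ι.range = π.ker) := by
  classical
  have hmem : ∀ x : B, x ∈ dKernel A B ↔ KaehlerDifferential.D A B x = 0 := fun x => Iff.rfl
  have h1 : ∀ b : B, p ^ n • KaehlerDifferential.D A B b = 0 → p ^ n • b ∈ dKernel A B := by
    intro b hb
    rw [hmem, map_nsmul, hb]
  have htor : ∀ (m : ℕ) (b : B), p ^ m • b = 0 → b = 0 := by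
    intro m
    induction m with
    | zero => intro b hb; simpa using hb
    | succ k ih =>
      intro b hb
      rw [pow_succ, mul_smul] at hb
      exact hBtor b (ih _ hb)
  have hdivn : ∀ (m : ℕ) (ω : Ω[B⁄A]), ∃ ω' : Ω[B⁄A], p ^ m • ω' = ω := by
    intro m
    induction m with
    | zero => intro ω; exact ⟨ω, by simp⟩
    | succ k ih =>
      intro ω
      obtain ⟨ω₁, h₁⟩ := ih ω
      obtain ⟨ω₂, h₂⟩ := hdiv ω₁
      exact ⟨ω₂, by rw [pow_succ, mul_smul, h₂, h₁]⟩
  have hcancel : ∀ b c : B, p ^ n • b = p ^ n • c → b = c := by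
    intro b c h
    rw [← sub_eq_zero]
    apply htor n
    rw [smul_sub, h, sub_self]
  have key : ∀ (x y : dKernel A B) (b c : B), (x : B) = p ^ n • b → (y : B) = p ^ n • c →
      KaehlerDifferential.D A B b = KaehlerDifferential.D A B c →
      (QuotientAddGroup.mk x : dKernel A B ⧸ (nsmulHom (p ^ n) (dKernel A B)).range) =
        QuotientAddGroup.mk y := by
    intro x y b c hx hy h
    rw [QuotientAddGroup.eq]
    refine ⟨⟨c - b, ?_⟩, ?_⟩
    · rw [hmem, map_sub, h, sub_self]
    · apply Subtype.ext
      change p ^ n • (c - b) = -(x : B) + (y : B)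
      rw [hx, hy, smul_sub]
      abel
  choose s hs using hsurj
  have hker : ∀ ω : (nsmulHom (p ^ n) (Ω[B⁄A])).ker, p ^ n • (ω : Ω[B⁄A]) = 0 :=
    fun ω => ω.2
  have hsm : ∀ ω : (nsmulHom (p ^ n) (Ω[B⁄A])).ker, p ^ n • s ω ∈ dKernel A B :=
    fun ω => h1 _ (by rw [hs]; exact hker ω)
  let ι : (nsmulHom (p ^ n) (Ω[B⁄A])).ker →+
          (dKernel A B ⧸ (nsmulHom (p ^ n) (dKernel A B)).range) :=
    AddMonoidHom.mk' (fun ω => QuotientAddGroup.mk ⟨p ^ n • s ω, hsm ω⟩) (by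
      intro a b
      rw [← QuotientAddGroup.mk_add]
      refine key _ _ (s (a + b : (nsmulHom (p ^ n) (Ω[B⁄A])).ker)) (s a + s b) rfl ?_ ?_
      · change p ^ n • s a + p ^ n • s b = _
        rw [smul_add]
      · rw [map_add, hs, hs, hs]; rfl)
  have hι : ∀ (ω : (nsmulHom (p ^ n) (Ω[B⁄A])).ker) (b : B),
        KaehlerDifferential.D A B b = (ω : Ω[B⁄A]) →
        ∀ x : dKernel A B, (x : B) = p ^ n • b → ι ω = QuotientAddGroup.mk x := by
    intro ω b hb x hx
    exact key _ _ (s ω) b rfl hx (by rw [hs, hb])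
  let π : (dKernel A B ⧸ (nsmulHom (p ^ n) (dKernel A B)).range) →+
          (B ⧸ (nsmulHom (p ^ n) B).range) :=
    QuotientAddGroup.map _ _ ((dKernel A B).val : dKernel A B →+ B) (by
      rintro _ ⟨y, rfl⟩
      exact ⟨(y : B), rfl⟩)
  have hπ : ∀ x : dKernel A B,
        π (QuotientAddGroup.mk x) = QuotientAddGroup.mk (x : B) := fun x => rfl
  refine ⟨h1, ι, π, hι, hπ, ?_, ?_, ?_⟩
  · rw [injective_iff_map_eq_zero]
    intro ω hω
    obtain ⟨c, hc⟩ := (QuotientAddGroup.eq_zero_iff _).1 hω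
    have hc' : p ^ n • (c : B) = p ^ n • s ω := congrArg Subtype.val hc
    have h2 := hcancel _ _ hc'
    apply Subtype.ext
    rw [← hs ω, ← h2]
    exact c.2
  · intro q
    obtain ⟨b, rfl⟩ := QuotientAddGroup.mk_surjective q
    obtain ⟨ω', hω'⟩ := hdivn n (KaehlerDifferential.D A B b)
    have hx : b - p ^ n • s ω' ∈ dKernel A B := by
      rw [hmem, map_sub, map_nsmul, hs, hω', sub_self]
    refine ⟨QuotientAddGroup.mk ⟨_, hx⟩, ?_⟩
    rw [hπ, QuotientAddGroup.eq]
    refine ⟨s ω', ?_⟩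
    change p ^ n • s ω' = -(b - p ^ n • s ω') + b
    abel
  · ext q
    constructor
    · rintro ⟨ω, rfl⟩
      exact (QuotientAddGroup.eq_zero_iff _).2 ⟨s ω, rfl⟩
    · intro hq
      obtain ⟨x, rfl⟩ := QuotientAddGroup.mk_surjective q
      obtain ⟨b, hb⟩ := (QuotientAddGroup.eq_zero_iff _).1 (show (QuotientAddGroup.mk (x : B) : B ⧸ (nsmulHom (p ^ n) B).range) = 0 from hq)
      have hb' : p ^ n • b = (x : B) := hb
      have hk : p ^ n • KaehlerDifferential.D A B b = 0 := by
        rw [← map_nsmul, hb']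
        exact x.2
      exact ⟨⟨KaehlerDifferential.D A B b, hk⟩, hι _ b rfl x hb'.symm⟩
end
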